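/- arXiv:2108.07885 — 7 statements merged into one kernel-verified Lean document; each statement's English description precedes it below -/
import Mathlib

section
/- For every vector v ∈ F^(F×F) with v ∉ K, the number of functions f : F → F such that Σ_{α∈F} v_(α, f(α)) = 0 is at most (q - 1) · q^(q-1); equivalently, a uniformly random function f : F → F satisfies Σ_{α∈F} v_(α, f(α)) = 0 with probability at most 1 - 1/q. -/
/-- The subspace `K`. -/
def Kset (F : Type*) [Field F] [Fintype F] : Set ((F × F) → F) :=
  {v | ∃ w : F → F, (∀ α β : F, v (α, β) = w α) ∧ ∑ α : F, w α = 0}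

/-- If every function can be made to satisfy `P` by changing its value at `a`, then at least
`|β| ^ (|ι| - 1)` functions satisfy `P`. -/
theorem pow_card_sub_one_le_card_of_exists_update {ι β : Type*} [Fintype ι] [DecidableEq ι]
    [Fintype β] [Nonempty β] (P : (ι → β) → Prop) (a : ι)
    (h : ∀ f, ∃ b, P (Function.update f a b)) :
    Fintype.card β ^ (Fintype.card ι - 1) ≤ Nat.card {f // P f} := by
  classical
  choose b hb using h
  let extend (g : {x // x ≠ a} → β) : ι → β :=
    fun x => if hx : x ≠ a then g ⟨x, hx⟩ else Classical.arbitrary β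
  let F (g : {x // x ≠ a} → β) : {f // P f} :=
    ⟨Function.update (extend g) a (b (extend g)), hb _⟩
  have hF : Function.Injective F := by
    intro g g' hgg
    funext x
    have hx := congrFun (congrArg Subtype.val hgg) x
    simpa [F, extend, Function.update_of_ne x.2, x.2] using hx
  have hcard := Nat.card_le_card_of_injective F hF
  simpa [Fintype.card_subtype_compl] using hcard

/-- For `v ∉ K` there is a coordinate at which every function can be changed so that the sum
does not vanish. -/
theorem exists_update_sum_ne_zero_of_notMem_Kset {F : Type*} [Field F] [Fintype F]
    [DecidableEq F] {v : (F × F) → F} (hv : v ∉ Kset F) :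
    ∃ a : F, ∀ f : F → F, ∃ b : F, ∑ α : F, v (α, Function.update f a b α) ≠ 0 := by
  by_cases hconst : ∀ α β : F, v (α, β) = v (α, 0)
  · refine ⟨0, fun f => ⟨0, fun hsum => hv ⟨fun α => v (α, 0), hconst, ?_⟩⟩⟩
    exact (Finset.sum_congr rfl fun α _ => (hconst α _).symm).trans hsum
  · push Not at hconst
    obtain ⟨a, b, hab⟩ := hconst
    refine ⟨a, fun f => ?_⟩
    by_contra! hzero
    have hsplit (c : F) : ∑ α : F, v (α, Function.update f a c α) =
        v (a, c) + ∑ α ∈ Finset.univ.erase a, v (α, f α) := by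
      rw [← Finset.add_sum_erase _ _ (Finset.mem_univ a), Function.update_self]
      congr 1
      refine Finset.sum_congr rfl fun α hα => ?_
      rw [Function.update_of_ne (Finset.ne_of_mem_erase hα)]
    refine hab (add_right_cancel (b := ∑ α ∈ Finset.univ.erase a, v (α, f α)) ?_)
    rw [← hsplit, ← hsplit, hzero, hzero]

/-- For every `v ∈ F^(F×F)` with `v ∉ K`, the number of functions
`f : F → F` with `∑ α, v (α, f α) = 0` is at most `(q - 1) · q^(q-1)`; equivalently, a
uniformly random `f : F → F` satisfies `∑ α, v (α, f α) = 0` with probability at most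
`1 - 1/q`. -/
theorem count_vanishing_sums_outside_K (F : Type*) [Field F] [Fintype F]
    (q : ℕ) (hq : q = Fintype.card F)
    (v : (F × F) → F) (hv : v ∉ Kset F) :
    Nat.card {f : F → F // ∑ α : F, v (α, f α) = 0} ≤ (q - 1) * q ^ (q - 1) ∧
    (Nat.card {f : F → F // ∑ α : F, v (α, f α) = 0} : ℝ) / (q : ℝ) ^ q
      ≤ 1 - 1 / (q : ℝ) := by
  classical
  obtain ⟨a, ha⟩ := exists_update_sum_ne_zero_of_notMem_Kset hv
  have hne := pow_card_sub_one_le_card_of_exists_update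
    (fun f : F → F => ∑ α : F, v (α, f α) ≠ 0) a ha
  have hpos : 0 < q := hq ▸ Fintype.card_pos
  have hcompl : Nat.card {f : F → F // ∑ α : F, v (α, f α) = 0} +
      Nat.card {f : F → F // ∑ α : F, v (α, f α) ≠ 0} = q ^ q := by
    rw [← Nat.card_sum, Nat.card_congr (Equiv.sumCompl _), Nat.card_eq_fintype_card,
      Fintype.card_fun, hq]
  rw [← hq] at hne
  have hpow : q ^ q = (q - 1) * q ^ (q - 1) + q ^ (q - 1) := by
    rw [← Nat.succ_mul, Nat.succ_eq_add_one, Nat.sub_add_cancel hpos, mul_pow_sub_one hpos.ne']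
  have hcount : Nat.card {f : F → F // ∑ α : F, v (α, f α) = 0} ≤ (q - 1) * q ^ (q - 1) := by
    lia
  refine ⟨hcount, ?_⟩
  have hposR : (0 : ℝ) < q := by exact_mod_cast hpos
  rw [div_le_iff₀ (pow_pos hposR q)]
  calc (Nat.card {f : F → F // ∑ α : F, v (α, f α) = 0} : ℝ)
      ≤ ((q - 1) * q ^ (q - 1) : ℕ) := by exact_mod_cast hcount
    _ = (1 - 1 / (q : ℝ)) * (q : ℝ) ^ q := by
      rw [← mul_pow_sub_one hpos.ne' (q : ℝ)]
      push_cast [Nat.cast_sub hpos]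
      field_simp
end

section
/- Fix a vector v ∈ F^(F×F) with v ∉ K and a positive integer m. Then the number of m-tuples (f_1, …, f_m) of functions f_i : F → F such that Σ_{α∈F} v_(α, f_i(α)) = 0 holds for every i ∈ [m] is at most ((q - 1) · q^(q-1))^m; equivalently, for independent uniformly random functions f_1, …, f_m : F → F, the probability that all m of these sums vanish is at most (1 - 1/q)^m. -/
/-- If the sum of `u i (f i)` depends on the value of `f` at `a`, then at least one of the possible
values at `a` is excluded once the values of `f` elsewhere are fixed. -/
theorem card_sum_eq_zero_le {ι κ M : Type*} [Fintype ι] [Fintype κ] [AddCommGroup M]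
    (u : ι → κ → M) {a : ι} {b c : κ} (hbc : u a b ≠ u a c) :
    Nat.card {f : ι → κ // ∑ i, u i (f i) = 0} ≤
      (Fintype.card κ - 1) * Fintype.card κ ^ (Fintype.card ι - 1) := by
  classical
  have sum_split (f : ι → κ) :
      ∑ i, u i (f i) = u a (f a) + ∑ i : {i // i ≠ a}, u i (f i) :=
    Fintype.sum_eq_add_sum_subtype_ne _ a
  rw [Nat.card_eq_fintype_card, Fintype.card_subtype]
  have card_codomain : Fintype.card ({i // i ≠ a} → κ) =
      Fintype.card κ ^ (Fintype.card ι - 1) := by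
    rw [Fintype.card_fun, Fintype.card_subtype_compl, Fintype.card_subtype_eq]
  rw [← card_codomain, ← Finset.card_univ (α := {i // i ≠ a} → κ)]
  refine Finset.card_le_mul_card_image_of_maps_to (f := fun f i => f i.1)
    (fun _ _ => Finset.mem_univ _) _ fun g _ => ?_
  obtain ⟨d, hd⟩ : ∃ d, u a d + ∑ i, u i.1 (g i) ≠ 0 := by
    by_contra! h
    exact hbc (add_right_cancel ((h b).trans (h c).symm))
  rw [← Finset.card_univ, ← Finset.card_erase_of_mem (Finset.mem_univ d)]
  refine Finset.card_le_card_of_injOn (fun f => f a) ?_ ?_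
  · intro f hf
    obtain ⟨hsum, rfl⟩ : ∑ i, u i (f i) = 0 ∧ (fun i : {i // i ≠ a} => f i.1) = g := by
      simpa using hf
    suffices f a ≠ d by simpa
    rintro rfl
    exact hd ((sum_split f).symm.trans hsum)
  · intro f hf f' hf' h
    have hr : (fun i : {i // i ≠ a} => f i.1) = fun i => f' i.1 :=
      (Finset.mem_filter.1 hf).2.trans (Finset.mem_filter.1 hf').2.symm
    ext i
    by_cases hi : i = a
    · subst hi
      exact h
    · exact congrFun hr ⟨i, hi⟩

theorem card_vanishing_sum_le_of_notMem_Kset {F : Type*} [Field F] [Fintype F]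
    {v : (F × F) → F} (hv : v ∉ Kset F) :
    Nat.card {f : F → F // ∑ α, v (α, f α) = 0} ≤
      (Fintype.card F - 1) * Fintype.card F ^ (Fintype.card F - 1) := by
  by_cases h : ∀ α β, v (α, β) = v (α, 0)
  · have : IsEmpty {f : F → F // ∑ α, v (α, f α) = 0} :=
      ⟨fun ⟨f, hf⟩ => hv ⟨fun α => v (α, 0), h, by simpa only [h _ (f _)] using hf⟩⟩
    simp
  · push Not at h
    obtain ⟨α, β, hαβ⟩ := h
    exact card_sum_eq_zero_le (fun α β => v (α, β)) hαβ

/-- Fix `v ∈ F^(F×F)` with `v ∉ K` and a positive integer `m`. Then the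
number of `m`-tuples `(f_1, …, f_m)` of functions `f_i : F → F` with
`∑ α, v (α, f_i α) = 0` for every `i` is at most `((q - 1) · q^(q-1))^m`; equivalently,
for independent uniformly random `f_1, …, f_m`, the probability that all `m` sums vanish
is at most `(1 - 1/q)^m`. -/
theorem count_tuples_vanishing_sums_outside_K (F : Type*) [Field F] [Fintype F]
    (q : ℕ) (hq : q = Fintype.card F)
    (v : (F × F) → F) (hv : v ∉ Kset F) (m : ℕ) (hm : 0 < m) :
    Nat.card {f : Fin m → F → F // ∀ i, ∑ α : F, v (α, f i α) = 0}
      ≤ ((q - 1) * q ^ (q - 1)) ^ m ∧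
    (Nat.card {f : Fin m → F → F // ∀ i, ∑ α : F, v (α, f i α) = 0} : ℝ)
        / (q : ℝ) ^ (q * m)
      ≤ (1 - 1 / (q : ℝ)) ^ m := by
  have count : Nat.card {f : Fin m → F → F // ∀ i, ∑ α : F, v (α, f i α) = 0}
      ≤ ((q - 1) * q ^ (q - 1)) ^ m := by
    rw [Nat.card_congr (Equiv.subtypePiEquivPi
      (p := fun (_ : Fin m) (g : F → F) => ∑ α : F, v (α, g α) = 0)), Nat.card_fun,
      Nat.card_fin, hq]
    exact Nat.pow_le_pow_left (card_vanishing_sum_le_of_notMem_Kset hv) m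
  refine ⟨count, ?_⟩
  have hq_pos : 0 < q := hq ▸ Fintype.card_pos
  have hq_real : (0 : ℝ) < q := Nat.cast_pos.2 hq_pos
  rw [div_le_iff₀ (by positivity), pow_mul, ← mul_pow]
  have bound_eq : (1 - 1 / (q : ℝ)) * (q : ℝ) ^ q = (((q - 1) * q ^ (q - 1) : ℕ) : ℝ) := by
    push_cast [Nat.cast_sub (Nat.one_le_iff_ne_zero.2 hq_pos.ne')]
    rw [← mul_pow_sub_one hq_pos.ne' (q : ℝ)]
    field_simp
  rw [bound_eq]
  exact_mod_cast count
end

section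
/- For any positive integer m, the number of m-tuples (f_1, …, f_m) of functions f_i : F → F for which there exists a vector v ∉ K with Σ_{α∈F} v_(α, f_i(α)) = 0 for every i ∈ [m] (i.e., for which Ker(A) strictly contains K) is at most q^(q²) · ((q - 1) · q^(q-1))^m; equivalently, for independent uniformly random functions f_1, …, f_m : F → F, the probability that Ker(A) ≠ K is at most q^(q²) · (1 - 1/q)^m. -/
/-- The matrix `A` with `A i (α,β) = 1` iff `f i α = β`. -/
def Amat {F : Type*} [Field F] [DecidableEq F] {m : ℕ} (f : Fin m → F → F) :
    Matrix (Fin m) (F × F) F :=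
  Matrix.of fun i p => if f i p.1 = p.2 then 1 else 0

/-- The kernel of `A`: the set of `v` with `∑_{(α,β)} A_{i,(α,β)} v_(α,β) = 0` for all `i`. -/
def kerSet {F : Type*} [Field F] [Fintype F] [DecidableEq F] {m : ℕ}
    (f : Fin m → F → F) : Set ((F × F) → F) :=
  {v | ∀ i, ∑ p : F × F, Amat f i p * v p = 0}

/-- If `u (a, ·)` is not constant, then each choice of the values of `f` away from `a` can be
completed in at most `|β| - 1` ways to a function `f` with `∑ x, u (x, f x) = 0`. -/
theorem card_filter_sum_eq_zero_le {α β G : Type*} [Fintype α] [DecidableEq α]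
    [Fintype β] [AddCommGroup G] [DecidableEq G] (u : α × β → G) (a : α)
    {b c : β} (hbc : u (a, b) ≠ u (a, c)) :
    (Finset.univ.filter fun f : α → β => ∑ x, u (x, f x) = 0).card ≤
      (Fintype.card β - 1) * Fintype.card β ^ (Fintype.card α - 1) := by
  classical
  have hcard : Fintype.card ({x // x ≠ a} → β) = Fintype.card β ^ (Fintype.card α - 1) := by
    simp [Fintype.card_subtype_compl]
  rw [← hcard, ← Finset.card_univ (α := {x // x ≠ a} → β)]
  refine Finset.card_le_mul_card_image_of_maps_to
    (f := fun (f : α → β) (x : {x // x ≠ a}) => f x) (fun _ _ => Finset.mem_univ _) _ ?_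
  intro g _
  let s : Finset β := Finset.univ.filter fun y => u (a, y) + ∑ x : {x // x ≠ a}, u (x, g x) = 0
  have hs : s.card ≤ Fintype.card β - 1 := by
    refine Nat.le_sub_one_of_lt (Finset.card_lt_univ_of_notMem (x := if b ∈ s then c else b) ?_)
    split_ifs with hb
    · intro hc
      simp only [s, Finset.mem_filter, Finset.mem_univ, true_and] at hb hc
      exact hbc (add_right_cancel (hb.trans hc.symm))
    · exact hb
  refine le_trans (Finset.card_le_card_of_injOn (fun f => f a) ?_ ?_) hs
  · intro f hf
    simp only [Finset.coe_filter, Finset.mem_filter, Finset.mem_univ, true_and,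
      Set.mem_ofPred_eq] at hf
    obtain ⟨hf, rfl⟩ := hf
    simp only [s, Finset.coe_filter, Finset.mem_univ, true_and, Set.mem_ofPred_eq]
    rw [← hf, Fintype.sum_eq_add_sum_subtype_ne _ a]
  · intro f hf f' hf' h
    simp only [Finset.coe_filter, Finset.mem_filter, Finset.mem_univ, true_and,
      Set.mem_ofPred_eq] at hf hf'
    funext x
    by_cases hx : x = a
    · rw [hx]; exact h
    · exact congrFun (hf.2.trans hf'.2.symm) ⟨x, hx⟩

/-- A vector outside `K` is orthogonal to at most `(q - 1) q^(q - 1)` rows coming from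
functions `F → F`. -/
theorem card_filter_sum_eq_zero_le_of_notMem_Kset {F : Type*} [Field F] [Fintype F]
    [DecidableEq F] {v : F × F → F} (hv : v ∉ Kset F) :
    (Finset.univ.filter fun f : F → F => ∑ x, v (x, f x) = 0).card ≤
      (Fintype.card F - 1) * Fintype.card F ^ (Fintype.card F - 1) := by
  by_cases h : ∃ a b c, v (a, b) ≠ v (a, c)
  · obtain ⟨a, b, c, hbc⟩ := h
    exact card_filter_sum_eq_zero_le v a hbc
  · push Not at h
    rw [Finset.filter_eq_empty_iff.mpr]
    · simp
    · intro f _ hf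
      exact hv ⟨fun x => v (x, f x), fun x y => h x y (f x), hf⟩

theorem sum_Amat_mul {F : Type*} [Field F] [Fintype F] [DecidableEq F] {m : ℕ}
    (f : Fin m → F → F) (i : Fin m) (v : F × F → F) :
    ∑ p : F × F, Amat f i p * v p = ∑ x, v (x, f i x) := by
  simp [Amat, Fintype.sum_prod_type]

theorem kerSet_ne_Kset_iff {F : Type*} [Field F] [Fintype F] [DecidableEq F] {m : ℕ}
    (f : Fin m → F → F) :
    kerSet f ≠ Kset F ↔ ∃ v ∉ Kset F, ∀ i, ∑ x, v (x, f i x) = 0 := by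
  have hsub : Kset F ⊆ kerSet f := by
    rintro v ⟨w, hw, hsum⟩ i
    rw [sum_Amat_mul]
    simpa [hw] using hsum
  have hmem (v : F × F → F) : v ∈ kerSet f ↔ ∀ i, ∑ x, v (x, f i x) = 0 :=
    forall_congr' fun i => by rw [sum_Amat_mul]
  rw [Ne, Set.Subset.antisymm_iff, and_iff_left hsub, Set.not_subset]
  exact exists_congr fun v => by rw [hmem, and_comm]

/-- The union bound over all vectors outside `K`. -/
theorem card_exists_notMem_Kset_le (F : Type*) [Field F] [Fintype F] [DecidableEq F] (m : ℕ) :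
    Nat.card {f : Fin m → F → F // ∃ v ∉ Kset F, ∀ i, ∑ x, v (x, f i x) = 0} ≤
      Fintype.card F ^ (Fintype.card F ^ 2) *
        ((Fintype.card F - 1) * Fintype.card F ^ (Fintype.card F - 1)) ^ m := by
  classical
  rw [Nat.card_eq_fintype_card, Fintype.card_subtype]
  let T : Finset (F × F → F) := Finset.univ.filter fun v => v ∉ Kset F
  let S (v : F × F → F) : Finset (F → F) :=
    Finset.univ.filter fun f => ∑ x, v (x, f x) = 0
  have hT : T.card ≤ Fintype.card F ^ (Fintype.card F ^ 2) := by
    refine (Finset.card_le_univ T).trans_eq ?_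
    simp [sq]
  calc
    _ ≤ (T.biUnion fun v => Fintype.piFinset fun _ : Fin m => S v).card := by
      refine Finset.card_le_card fun f hf => ?_
      simpa [T, S] using hf
    _ ≤ T.card * ((Fintype.card F - 1) * Fintype.card F ^ (Fintype.card F - 1)) ^ m := by
      refine Finset.card_biUnion_le_card_mul _ _ _ fun v hv => ?_
      rw [Fintype.card_piFinset_const]
      exact Nat.pow_le_pow_left
        (card_filter_sum_eq_zero_le_of_notMem_Kset (Finset.mem_filter.mp hv).2) m
    _ ≤ _ := Nat.mul_le_mul_right _ hT

/-- For any positive integer `m`, the number of `m`-tuples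
`(f_1, …, f_m)` for which there exists `v ∉ K` with `∑ α, v (α, f_i α) = 0` for every `i`
(i.e., for which `Ker(A)` strictly contains `K`) is at most
`q^(q²) · ((q - 1) · q^(q-1))^m`; equivalently, for independent uniformly random
`f_1, …, f_m`, the probability that `Ker(A) ≠ K` is at most `q^(q²) · (1 - 1/q)^m`. -/
theorem union_bound_kernel_not_K (F : Type*) [Field F] [Fintype F] [DecidableEq F]
    (q : ℕ) (hq : q = Fintype.card F) (m : ℕ) (hm : 0 < m) :
    Nat.card {f : Fin m → F → F //
        ∃ v ∉ Kset F, ∀ i, ∑ α : F, v (α, f i α) = 0}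
      ≤ q ^ (q ^ 2) * ((q - 1) * q ^ (q - 1)) ^ m ∧
    (Nat.card {f : Fin m → F → F // kerSet f ≠ Kset F} : ℝ) / (q : ℝ) ^ (q * m)
      ≤ (q : ℝ) ^ (q ^ 2) * (1 - 1 / (q : ℝ)) ^ m := by
  subst hq
  have hcount := card_exists_notMem_Kset_le F m
  refine ⟨hcount, ?_⟩
  simp only [kerSet_ne_Kset_iff]
  have hpos : 0 < Fintype.card F := Fintype.card_pos
  generalize Fintype.card F = q at hcount hpos ⊢
  obtain ⟨n, rfl⟩ := Nat.exists_eq_succ_of_ne_zero hpos.ne'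
  have hq : ((n : ℝ) + 1) ≠ 0 := by positivity
  rw [div_le_iff₀ (by positivity)]
  refine (Nat.cast_le (α := ℝ).mpr hcount).trans_eq ?_
  rw [pow_mul, mul_assoc, ← mul_pow]
  simp only [Nat.succ_eq_add_one, Nat.add_sub_cancel]
  push_cast
  congr 2
  rw [pow_succ]
  field_simp
  ring
end

section
/- Let λ ≥ 2 be an integer, suppose q = λ², and set m = λ^100. Then for independent uniformly random functions f_1, …, f_m : F → F, the probability that Ker(A) ≠ K is at most exp(q² log q − m/q), which is at most exp(−λ^97). -/
theorem mem_kerSet_iff {F : Type*} [Field F] [Fintype F] [DecidableEq F] {m : ℕ}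
    (f : Fin m → F → F) (v : F × F → F) :
    v ∈ kerSet f ↔ ∀ i, ∑ α, v (α, f i α) = 0 := by
  simp [kerSet, Amat, Fintype.sum_prod_type]

theorem Kset_subset_kerSet {F : Type*} [Field F] [Fintype F] [DecidableEq F] {m : ℕ}
    (f : Fin m → F → F) : Kset F ⊆ kerSet f := by
  rintro v ⟨w, hw, hsum⟩
  rw [mem_kerSet_iff]
  intro i
  simpa [hw] using hsum

/-- Some value at `a` makes the sum nonzero if `v (a, ·)` is not constant. -/
theorem exists_sum_update_ne_zero {α β M : Type*} [Fintype α] [DecidableEq α] [AddCommGroup M]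
    (v : α × β → M) (a : α) {b c : β} (hbc : v (a, b) ≠ v (a, c)) (g : α → β) :
    ∃ d, ∑ x, v (x, Function.update g a d x) ≠ 0 := by
  have key (d : β) : ∑ x, v (x, Function.update g a d x) =
      v (a, d) + ∑ x ∈ Finset.univ.erase a, v (x, g x) := by
    rw [← Finset.add_sum_erase _ _ (Finset.mem_univ a), Function.update_self]
    congr 1
    refine Finset.sum_congr rfl fun x hx => ?_
    rw [Function.update_of_ne (Finset.ne_of_mem_erase hx)]
  by_contra! h
  have hb := h b
  have hc := h c
  rw [key] at hb hc
  exact hbc (add_right_cancel (hb.trans hc.symm))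

theorem card_pow_le_card_sum_ne_zero {F : Type*} [Field F] [Fintype F] [DecidableEq F]
    {v : F × F → F} (hv : v ∉ Kset F) :
    Fintype.card F ^ (Fintype.card F - 1) ≤
      (Finset.univ.filter fun g : F → F => ∑ α, v (α, g α) ≠ 0).card := by
  by_cases hconst : ∀ α β γ, v (α, β) = v (α, γ)
  · have hsum : ∑ α, v (α, 0) ≠ 0 := fun h =>
      hv ⟨fun α => v (α, 0), fun α β => hconst α β 0, h⟩
    have hall : (Finset.univ.filter fun g : F → F => ∑ α, v (α, g α) ≠ 0) = Finset.univ := by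
      refine Finset.filter_true_of_mem fun g _ => ?_
      rwa [Finset.sum_congr rfl fun α _ => hconst α (g α) 0]
    rw [hall, Finset.card_univ, Fintype.card_fun]
    exact Nat.pow_le_pow_right Fintype.card_pos (Nat.sub_le _ _)
  · push Not at hconst
    obtain ⟨a, b, c, hbc⟩ := hconst
    have hcard : Fintype.card ({x // x ≠ a} → F) = Fintype.card F ^ (Fintype.card F - 1) := by
      simp
    rw [← hcard, ← Fintype.card_coe]
    refine Fintype.card_le_of_surjective
      (fun g (x : {x // x ≠ a}) => g.1 x.1) fun h => ?_
    obtain ⟨d, hd⟩ := exists_sum_update_ne_zero v a hbc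
      (fun x => if hx : x ≠ a then h ⟨x, hx⟩ else 0)
    refine ⟨⟨_, by simpa using hd⟩, ?_⟩
    ext ⟨x, hx⟩
    simp [hx]

theorem card_sum_eq_zero_le_s8 {F : Type*} [Field F] [Fintype F] [DecidableEq F]
    {v : F × F → F} (hv : v ∉ Kset F) :
    ((Finset.univ.filter fun g : F → F => ∑ α, v (α, g α) = 0).card : ℝ) ≤
      (Fintype.card F : ℝ) ^ Fintype.card F * Real.exp (-(1 / (Fintype.card F : ℝ))) := by
  have hpos : 0 < Fintype.card F := Fintype.card_pos
  have hsplit := Finset.card_filter_add_card_filter_not (s := Finset.univ)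
    (fun g : F → F => ∑ α, v (α, g α) = 0)
  rw [Finset.card_univ, Fintype.card_fun] at hsplit
  have hle := card_pow_le_card_sum_ne_zero hv
  have hsplit' := congrArg (Nat.cast : ℕ → ℝ) hsplit
  have hle' : ((_ : ℕ) : ℝ) ≤ _ := Nat.cast_le.mpr hle
  push_cast at hsplit' hle'
  have hpow : (Fintype.card F : ℝ) ^ Fintype.card F * (1 / (Fintype.card F : ℝ)) =
      (Fintype.card F : ℝ) ^ (Fintype.card F - 1) := by
    have hpos' : (Fintype.card F : ℝ) ≠ 0 := by positivity
    rw [mul_one_div, div_eq_iff hpos', ← pow_succ, Nat.sub_add_cancel hpos]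
  have hexp := Real.add_one_le_exp (-(1 / (Fintype.card F : ℝ)))
  have hmul := mul_le_mul_of_nonneg_left hexp
    (by positivity : (0 : ℝ) ≤ (Fintype.card F : ℝ) ^ Fintype.card F)
  refine le_trans ?_ hmul
  rw [mul_add, mul_neg, hpow, mul_one]
  linarith

theorem card_kerSet_ne_Kset_le (F : Type*) [Field F] [Fintype F] [DecidableEq F] (m : ℕ) :
    (Nat.card {f : Fin m → F → F // kerSet f ≠ Kset F} : ℝ) ≤
      (Fintype.card F : ℝ) ^ (Fintype.card F ^ 2) *
        ((Fintype.card F : ℝ) ^ Fintype.card F * Real.exp (-(1 / (Fintype.card F : ℝ)))) ^ m := by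
  classical
  let Z (v : F × F → F) : Finset (F → F) := Finset.univ.filter fun g => ∑ α, v (α, g α) = 0
  let V : Finset (F × F → F) := Finset.univ.filter fun v => v ∉ Kset F
  have hsub : (Finset.univ.filter fun f : Fin m → F → F => kerSet f ≠ Kset F) ⊆
      V.biUnion fun v => Fintype.piFinset fun _ : Fin m => Z v := by
    intro f hf
    have hne : kerSet f ≠ Kset F := by simpa using hf
    obtain ⟨v, hv, hvK⟩ := Set.not_subset.mp fun h => hne (h.antisymm (Kset_subset_kerSet f))
    rw [mem_kerSet_iff] at hv
    simp only [Finset.mem_biUnion, Fintype.mem_piFinset]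
    exact ⟨v, by simpa [V] using hvK, fun i => by simpa [Z] using hv i⟩
  rw [Nat.card_eq_fintype_card, Fintype.card_subtype]
  calc ((Finset.univ.filter fun f : Fin m → F → F => kerSet f ≠ Kset F).card : ℝ)
      ≤ ∑ v ∈ V, ((Z v).card : ℝ) ^ m := by
        have h := (Finset.card_le_card hsub).trans Finset.card_biUnion_le
        simp only [Fintype.card_piFinset_const] at h
        exact_mod_cast h
    _ ≤ ∑ v ∈ V, ((Fintype.card F : ℝ) ^ Fintype.card F *
          Real.exp (-(1 / (Fintype.card F : ℝ)))) ^ m := by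
        refine Finset.sum_le_sum fun v hv => pow_le_pow_left₀ (by positivity) ?_ _
        exact card_sum_eq_zero_le_s8 (by simpa [V] using hv)
    _ ≤ _ := by
        rw [Finset.sum_const, nsmul_eq_mul]
        refine mul_le_mul_of_nonneg_right ?_ (by positivity)
        have h := Finset.card_le_univ V
        rw [Fintype.card_fun, Fintype.card_prod, ← sq] at h
        exact_mod_cast h

theorem sq_mul_log_sub_div_le (lam : ℕ) (hlam : 2 ≤ lam) :
    ((lam ^ 2 : ℕ) : ℝ) ^ 2 * Real.log (lam ^ 2 : ℕ) - ((lam ^ 100 : ℕ) : ℝ) / (lam ^ 2 : ℕ) ≤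
      -(lam : ℝ) ^ 97 := by
  have hl : (2 : ℝ) ≤ lam := by exact_mod_cast hlam
  have hpos : (0 : ℝ) < lam := by linarith
  push_cast
  have hdiv : (lam : ℝ) ^ 100 / (lam : ℝ) ^ 2 = (lam : ℝ) * (lam : ℝ) ^ 97 := by
    field_simp
  have hlog : Real.log ((lam : ℝ) ^ 2) ≤ (lam : ℝ) ^ 2 := Real.log_le_self (by positivity)
  have hleft : ((lam : ℝ) ^ 2) ^ 2 * Real.log ((lam : ℝ) ^ 2) ≤ (lam : ℝ) ^ 97 :=
    calc ((lam : ℝ) ^ 2) ^ 2 * Real.log ((lam : ℝ) ^ 2)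
        ≤ ((lam : ℝ) ^ 2) ^ 2 * (lam : ℝ) ^ 2 := by gcongr
      _ = (lam : ℝ) ^ 6 := by ring
      _ ≤ (lam : ℝ) ^ 97 := pow_le_pow_right₀ (by linarith) (by norm_num)
  have hright : 2 * (lam : ℝ) ^ 97 ≤ (lam : ℝ) * (lam : ℝ) ^ 97 := by gcongr
  rw [hdiv]
  linarith

/-- Let `λ ≥ 2`, suppose `q = λ²`, and set `m = λ^100`. Then for
independent uniformly random `f_1, …, f_m : F → F`, the probability that `Ker(A) ≠ K`
is at most `exp(q² log q − m/q)`, which is at most `exp(−λ^97)`. -/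
theorem prob_kernel_not_K_small (F : Type*) [Field F] [Fintype F] [DecidableEq F]
    (lam q m : ℕ) (hlam : 2 ≤ lam) (hq : q = Fintype.card F)
    (hqlam : q = lam ^ 2) (hm : m = lam ^ 100) :
    (Nat.card {f : Fin m → F → F // kerSet f ≠ Kset F} : ℝ) / (q : ℝ) ^ (q * m)
      ≤ Real.exp ((q : ℝ) ^ 2 * Real.log q - (m : ℝ) / q) ∧
    Real.exp ((q : ℝ) ^ 2 * Real.log q - (m : ℝ) / q)
      ≤ Real.exp (-(lam : ℝ) ^ 97) := by
  refine ⟨?_, ?_⟩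
  · have hpos : (0 : ℝ) < q := by
      rw [hq]
      exact_mod_cast Fintype.card_pos
    have h := card_kerSet_ne_Kset_le F m
    rw [← hq, mul_pow, ← pow_mul, ← Real.exp_nat_mul] at h
    rw [div_le_iff₀ (by positivity)]
    refine h.trans_eq ?_
    have hqq : (q : ℝ) ^ (q ^ 2) = Real.exp ((q : ℝ) ^ 2 * Real.log q) := by
      rw [← Real.exp_log (pow_pos hpos (q ^ 2)), Real.log_pow]
      push_cast
      rfl
    have hdiv : (m : ℝ) * -(1 / (q : ℝ)) = -((m : ℝ) / q) := by ring
    rw [hqq, hdiv, sub_eq_add_neg, Real.exp_add]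
    ring
  · rw [Real.exp_le_exp, hm, hqlam]
    exact sq_mul_log_sub_div_le lam hlam
end

section
/- Suppose q ≥ 2 and f_1, …, f_m : F → F are the evaluation maps of polynomials p_1, …, p_m ∈ F[X], each of degree strictly less than q - 1. Then the rank of the matrix A is at most q² - q, i.e., strictly less than q² - q + 1. -/
/-- Over a finite field, the values of a polynomial of degree below `#F - 1` sum to zero. -/
theorem sum_eval_eq_zero_of_degree_lt {F : Type*} [Field F] [Fintype F] (p : Polynomial F)
    (hp : p.degree < ((Fintype.card F - 1 : ℕ) : WithBot ℕ)) : ∑ x, p.eval x = 0 := by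
  simp_rw [Polynomial.eval_eq_sum, Polynomial.sum_def]
  rw [Finset.sum_comm]
  refine Finset.sum_eq_zero fun n hn => ?_
  have hn' : n < Fintype.card F - 1 := by
    exact_mod_cast (Polynomial.le_degree_of_mem_supp n hn).trans_lt hp
  rw [← Finset.mul_sum, FiniteField.sum_pow_lt_card_sub_one F n hn', mul_zero]

/-- A parametrization of column vectors, whose image annihilates the rows of `Amat f` as soon as
the values of each `f i` sum to zero. -/
def kernelParam (F : Type*) [Field F] [Fintype F] [DecidableEq F] :
    (F → F) →ₗ[F] (F × F → F) where
  toFun c x := c x.1 - (if x.1 = 0 then ∑ a, c a else 0) + (∑ a, c a) * x.2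
  map_add' c d := by
    ext x
    simp only [Pi.add_apply, Finset.sum_add_distrib]
    split_ifs <;> ring
  map_smul' r c := by
    ext x
    simp only [Pi.smul_apply, smul_eq_mul, RingHom.id_apply, ← Finset.mul_sum]
    split_ifs <;> ring

theorem kernelParam_injective (F : Type*) [Field F] [Fintype F] [DecidableEq F] :
    Function.Injective (kernelParam F) := by
  rw [injective_iff_map_eq_zero]
  intro c hc
  have h (a b : F) : c a - (if a = 0 then ∑ a, c a else 0) + (∑ a, c a) * b = 0 :=
    congrFun hc (a, b)
  have hsum : ∑ a, c a = 0 := by linear_combination h 0 1 - h 0 0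
  ext a
  simpa [hsum] using h a 0

theorem Amat_mulVec_kernelParam {F : Type*} [Field F] [Fintype F] [DecidableEq F] {m : ℕ}
    (f : Fin m → F → F) (hf : ∀ i, ∑ x, f i x = 0) (c : F → F) :
    (Amat f).mulVec (kernelParam F c) = 0 := by
  ext i
  simp [Matrix.mulVec, dotProduct, Amat, kernelParam, Fintype.sum_prod_type,
    Finset.sum_add_distrib, ← Finset.mul_sum, hf]

/-- If the values of each `f i` sum to zero, the kernel of `Amat f` has dimension at least `#F`. -/
theorem rank_Amat_add_card_le {F : Type*} [Field F] [Fintype F] [DecidableEq F] {m : ℕ}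
    (f : Fin m → F → F) (hf : ∀ i, ∑ x, f i x = 0) :
    (Amat f).rank + Fintype.card F ≤ Fintype.card F ^ 2 := by
  have hle : LinearMap.range (kernelParam F) ≤ LinearMap.ker (Amat f).mulVecLin := by
    rintro _ ⟨c, rfl⟩
    exact Amat_mulVec_kernelParam f hf c
  have hker := Submodule.finrank_mono hle
  rw [LinearMap.finrank_range_of_inj (kernelParam_injective F), Module.finrank_fintype_fun_eq_card]
    at hker
  have hrank := (Amat f).mulVecLin.finrank_range_add_finrank_ker
  rw [Module.finrank_fintype_fun_eq_card, Fintype.card_prod, ← sq] at hrank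
  rw [Matrix.rank]
  omega

/-- Suppose `q ≥ 2` and `f_1, …, f_m` are evaluation maps of
polynomials of degree strictly less than `q - 1`. Then `rank(A) ≤ q² - q`, i.e.,
`rank(A) < q² - q + 1`. -/
theorem rank_lt_of_polynomials (F : Type*) [Field F] [Fintype F] [DecidableEq F]
    (q : ℕ) (hq : q = Fintype.card F) (hq2 : 2 ≤ q)
    (m : ℕ) (ps : Fin m → Polynomial F)
    (hdeg : ∀ i, (ps i).degree < ((q - 1 : ℕ) : WithBot ℕ))
    (f : Fin m → F → F) (hf : ∀ i x, f i x = (ps i).eval x) :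
    (Amat f).rank ≤ q ^ 2 - q ∧ (Amat f).rank < q ^ 2 - q + 1 := by
  subst hq
  have h := rank_Amat_add_card_le f fun i => by
    simpa only [hf] using sum_eval_eq_zero_of_degree_lt (ps i) (hdeg i)
  omega
end

section
/- (Proposition, Case (1).) Suppose q ≥ 2. Let π be any permutation of F × F, let λ < q - 1, and let p_1, …, p_m ∈ F[X] be polynomials of degree at most λ. For each i ∈ [m], let S_i = {π(x, p_i(x)) : x ∈ F}, and define the matrix M ∈ F^(m × (F×F)) by M_{i,(α,β)} = 1 if (α,β) ∈ S_i and 0 otherwise. Then rank(M) < q² - q + 1. -/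
/-- The matrix `M` whose `i`-th row is the indicator of `S_i = {π(x, p_i(x)) : x ∈ F}`. -/
noncomputable def MmatPoly {F : Type*} [Field F] [Fintype F] (π : Equiv.Perm (F × F)) {m : ℕ}
    (ps : Fin m → Polynomial F) : Matrix (Fin m) (F × F) F :=
  Matrix.of fun i p =>
    Set.indicator {y : F × F | ∃ x : F, π (x, (ps i).eval x) = y} (fun _ => 1) p

open Polynomial in
/-- The values of a polynomial of degree less than `q - 1` sum to zero over a field with `q`
elements. -/
theorem sum_eval_eq_zero_of_natDegree_lt {F : Type*} [Field F] [Fintype F] (p : F[X])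
    (hp : p.natDegree < Fintype.card F - 1) : ∑ x : F, p.eval x = 0 := by
  simp_rw [eval_eq_sum_range]
  rw [Finset.sum_comm]
  refine Finset.sum_eq_zero fun i hi => ?_
  rw [← Finset.mul_sum, FiniteField.sum_pow_lt_card_sub_one F i, mul_zero]
  have := Finset.mem_range.mp hi
  omega

theorem MmatPoly_mulVec {F : Type*} [Field F] [Fintype F] (π : Equiv.Perm (F × F)) {m : ℕ}
    (ps : Fin m → Polynomial F) (w : F × F → F) (i : Fin m) :
    (MmatPoly π ps).mulVec w i = ∑ x : F, w (π (x, (ps i).eval x)) := by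
  classical
  rw [Matrix.mulVec, dotProduct, ← Equiv.sum_comp π, Fintype.sum_prod_type]
  refine Finset.sum_congr rfl fun x _ => ?_
  simp [MmatPoly, Set.indicator_apply]

open Classical in
/-- The function `(x, y) ↦ g x - [x = 0] ∑ g + g 0 * y`, transported along `π`. Its sum over the
graph of a polynomial of degree less than `q - 1` vanishes. -/
noncomputable def graphAnnihilator {F : Type*} [Field F] [Fintype F] (π : Equiv.Perm (F × F)) :
    (F → F) →ₗ[F] (F × F → F) where
  toFun g z := g (π.symm z).1 - (if (π.symm z).1 = 0 then ∑ x, g x else 0)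
    + g 0 * (π.symm z).2
  map_add' g h := by
    ext z
    simp only [Pi.add_apply, Finset.sum_add_distrib]
    split_ifs <;> ring
  map_smul' c g := by
    ext z
    simp only [Pi.smul_apply, smul_eq_mul, RingHom.id_apply, ← Finset.mul_sum]
    split_ifs <;> ring

open Classical in
theorem graphAnnihilator_apply {F : Type*} [Field F] [Fintype F] (π : Equiv.Perm (F × F))
    (g : F → F) (x y : F) :
    graphAnnihilator π g (π (x, y)) = g x - (if x = 0 then ∑ t, g t else 0) + g 0 * y := by
  simp [graphAnnihilator]

theorem graphAnnihilator_injective {F : Type*} [Field F] [Fintype F] (π : Equiv.Perm (F × F)) :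
    Function.Injective (graphAnnihilator π) := by
  rw [injective_iff_map_eq_zero]
  intro g hg
  have h (x y : F) := (graphAnnihilator_apply π g x y).symm.trans (congrFun hg (π (x, y)))
  have h0 : g 0 = 0 := by
    have h1 := h 0 1
    have h2 := h 0 0
    simp only [Pi.zero_apply] at h1 h2
    linear_combination h1 - h2
  ext x
  by_cases hx : x = 0
  · simp [hx, h0]
  · simpa [hx] using h x 0

theorem MmatPoly_mulVec_graphAnnihilator {F : Type*} [Field F] [Fintype F]
    (π : Equiv.Perm (F × F)) {m : ℕ} (ps : Fin m → Polynomial F)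
    (hps : ∀ i, (ps i).natDegree < Fintype.card F - 1) (g : F → F) :
    (MmatPoly π ps).mulVec (graphAnnihilator π g) = 0 := by
  classical
  ext i
  simp [MmatPoly_mulVec, graphAnnihilator_apply, Finset.sum_add_distrib, ← Finset.mul_sum,
    sum_eval_eq_zero_of_natDegree_lt _ (hps i)]

/-- **Proposition, Case (1).** Suppose `q ≥ 2`. Let `π` be any permutation
of `F × F`, `λ < q - 1`, and `p_1, …, p_m ∈ F[X]` of degree at most `λ`, with
`S_i = {π(x, p_i(x)) : x ∈ F}` and `M i (α,β) = 1` iff `(α,β) ∈ S_i`. Then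
`rank(M) < q² - q + 1`. -/
theorem rank_lt_case_one (F : Type*) [Field F] [Fintype F]
    (q : ℕ) (hq : q = Fintype.card F) (hq2 : 2 ≤ q)
    (π : Equiv.Perm (F × F)) (lam : ℕ) (hlam : lam < q - 1)
    (m : ℕ) (ps : Fin m → Polynomial F)
    (hdeg : ∀ i, (ps i).degree ≤ (lam : WithBot ℕ)) :
    (MmatPoly π ps).rank < q ^ 2 - q + 1 := by
  subst hq
  have hnat (i : Fin m) : (ps i).natDegree < Fintype.card F - 1 :=
    (Polynomial.natDegree_le_of_degree_le (hdeg i)).trans_lt hlam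
  have hker : Fintype.card F ≤ Module.finrank F (MmatPoly π ps).mulVecLin.ker := by
    rw [← Module.finrank_fintype_fun_eq_card F,
      ← LinearMap.finrank_range_of_inj (graphAnnihilator_injective π)]
    refine Submodule.finrank_mono ?_
    rintro _ ⟨g, rfl⟩
    exact MmatPoly_mulVec_graphAnnihilator π ps hnat g
  have hrn := (MmatPoly π ps).mulVecLin.finrank_range_add_finrank_ker
  rw [Module.finrank_fintype_fun_eq_card, Fintype.card_prod, ← sq] at hrn
  change (MmatPoly π ps).rank + _ = _ at hrn
  omega
end

section
/- (Proposition, Case (2).) Let π be any permutation of F × F and let m be a positive integer. For functions f_1, …, f_m : F → F, let T_i = {π(x, f_i(x)) : x ∈ F} and define the matrix M ∈ F^(m × (F×F)) by M_{i,(α,β)} = 1 if (α,β) ∈ T_i and 0 otherwise. Then for independent uniformly random functions f_1, …, f_m : F → F, the probability that rank(M) = q² - q + 1 is at least 1 − q^(q²) · (1 − 1/q)^m. -/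
/-- The matrix `M` whose `i`-th row is the indicator of `T_i = {π(x, f_i(x)) : x ∈ F}`. -/
noncomputable def Mmat {F : Type*} [Field F] [Fintype F] (π : Equiv.Perm (F × F)) {m : ℕ}
    (f : Fin m → F → F) : Matrix (Fin m) (F × F) F :=
  Matrix.of fun i p =>
    Set.indicator {y : F × F | ∃ x : F, π (x, f i x) = y} (fun _ => 1) p

/-- The linear form `w ↦ ∑ x, w (π (x, g x))`, i.e. pairing with the indicator of
`{π (x, g x) : x ∈ F}`. -/
def transversalSum {F : Type*} [Field F] [Fintype F] (π : Equiv.Perm (F × F)) (g : F → F) :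
    (F × F → F) →ₗ[F] F :=
  ∑ x, LinearMap.proj (π (x, g x))

theorem transversalSum_apply {F : Type*} [Field F] [Fintype F] (π : Equiv.Perm (F × F))
    (g : F → F) (w : F × F → F) : transversalSum π g w = ∑ x, w (π (x, g x)) := by
  simp [transversalSum]

theorem Mmat_mulVec {F : Type*} [Field F] [Fintype F] (π : Equiv.Perm (F × F)) {m : ℕ}
    (f : Fin m → F → F) (w : F × F → F) (i : Fin m) :
    (Mmat π f).mulVec w i = transversalSum π (f i) w := by
  classical
  rw [transversalSum_apply]
  have key : ∀ p : F × F, Mmat π f i (π p) = if f i p.1 = p.2 then 1 else 0 := by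
    rintro ⟨a, b⟩
    simp only [Mmat, Matrix.of_apply, Set.indicator_apply, Set.mem_ofPred_eq,
      EmbeddingLike.apply_eq_iff_eq, Prod.mk.injEq, exists_eq_left]
  rw [Matrix.mulVec, dotProduct, ← Equiv.sum_comp π]
  simp only [key, Fintype.sum_prod_type]
  simp

/-- The common kernel of all forms `transversalSum π g`. -/
def transversalKer {F : Type*} [Field F] [Fintype F] (π : Equiv.Perm (F × F)) :
    Submodule F (F × F → F) :=
  ⨅ g : F → F, LinearMap.ker (transversalSum π g)

theorem mem_transversalKer {F : Type*} [Field F] [Fintype F] {π : Equiv.Perm (F × F)}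
    {w : F × F → F} : w ∈ transversalKer π ↔ ∀ g, transversalSum π g w = 0 := by
  simp [transversalKer]

theorem sum_update_right {F : Type*} [Field F] [Fintype F] [DecidableEq F] (h : F → F → F)
    (g : F → F) (x₀ y : F) :
    ∑ x, h x (Function.update g x₀ y x) = h x₀ y + ∑ x ∈ Finset.univ.erase x₀, h x (g x) := by
  rw [← Finset.add_sum_erase _ _ (Finset.mem_univ x₀), Function.update_self]
  congr 1
  refine Finset.sum_congr rfl fun x hx => ?_
  rw [Function.update_of_ne (Finset.ne_of_mem_erase hx)]

theorem finrank_transversalKer_add_one {F : Type*} [Field F] [Fintype F]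
    (π : Equiv.Perm (F × F)) :
    Module.finrank F (transversalKer π) + 1 = Fintype.card F := by
  classical
  let s : (F → F) →ₗ[F] F := ∑ x, LinearMap.proj x
  have hs : ∀ c, s c = ∑ x, c x := fun c => by simp [s]
  let e : (F → F) →ₗ[F] (F × F → F) := LinearMap.funLeft F F fun p => (π.symm p).1
  have he : Function.Injective e :=
    LinearMap.funLeft_injective_of_surjective F F _
      (fun x => ⟨π (x, 0), by simp⟩)
  have hmap : transversalKer π = (LinearMap.ker s).map e := by
    ext w
    rw [mem_transversalKer, Submodule.mem_map]
    constructor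
    · intro hw
      simp only [transversalSum_apply] at hw
      refine ⟨fun x => w (π (x, 0)), ?_, ?_⟩
      · rw [LinearMap.mem_ker, hs]
        exact hw fun _ => 0
      · funext p
        obtain ⟨⟨a, b⟩, rfl⟩ := π.surjective p
        have h0 := hw (Function.update 0 a 0)
        have h1 := hw (Function.update 0 a b)
        rw [sum_update_right fun x y => w (π (x, y))] at h0 h1
        simpa [e, LinearMap.funLeft_apply] using add_right_cancel (h0.trans h1.symm)
    · rintro ⟨c, hc, rfl⟩ g
      rw [LinearMap.mem_ker, hs] at hc
      simpa [transversalSum_apply, e, LinearMap.funLeft_apply] using hc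
  have hsurj : LinearMap.range s = ⊤ := by
    rw [LinearMap.range_eq_top]
    exact fun a => ⟨Pi.single 0 a, by simp [hs]⟩
  have h := LinearMap.finrank_range_add_finrank_ker s
  rw [hsurj, finrank_top, Module.finrank_self, Module.finrank_fintype_fun_eq_card] at h
  rw [hmap, (Submodule.equivMapOfInjective e he _).finrank_eq.symm]
  omega

theorem rank_Mmat_eq {F : Type*} [Field F] [Fintype F] (π : Equiv.Perm (F × F)) {m : ℕ}
    (f : Fin m → F → F)
    (hf : ∀ w, (∀ i, transversalSum π (f i) w = 0) → w ∈ transversalKer π) :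
    (Mmat π f).rank = Fintype.card F ^ 2 - Fintype.card F + 1 := by
  have hker : LinearMap.ker (Mmat π f).mulVecLin = transversalKer π := by
    ext w
    rw [LinearMap.mem_ker, Matrix.mulVecLin_apply, funext_iff]
    simp only [Mmat_mulVec, Pi.zero_apply]
    exact ⟨hf w, fun h i => mem_transversalKer.1 h _⟩
  have h := LinearMap.finrank_range_add_finrank_ker (Mmat π f).mulVecLin
  have h1 := finrank_transversalKer_add_one π
  rw [hker, Module.finrank_fintype_fun_eq_card, Fintype.card_prod, ← sq] at h
  have h2 : Fintype.card F ≤ Fintype.card F ^ 2 := Nat.le_self_pow two_ne_zero _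
  rw [Matrix.rank]
  omega

/-- If `g ↦ ∑ x, h x (g x)` is not identically zero, it is nonzero with probability at least
`1 / |F|`. -/
theorem card_fun_le_card_sum_ne_zero_mul {F : Type*} [Field F] [Fintype F] [DecidableEq F]
    (h : F → F → F) (g₀ : F → F) (hg₀ : ∑ x, h x (g₀ x) ≠ 0) :
    Fintype.card (F → F) ≤
      Fintype.card {g : F → F // ∑ x, h x (g x) ≠ 0} * Fintype.card F := by
  obtain ⟨x₀, hx₀⟩ : ∃ x₀, ∀ g : F → F, ∃ y, ∑ x, h x (Function.update g x₀ y x) ≠ 0 := by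
    by_cases hc : ∃ x y z, h x y ≠ h x z
    · obtain ⟨x₀, y, z, hyz⟩ := hc
      refine ⟨x₀, fun g => ?_⟩
      by_contra! H
      have hy := H y
      have hz := H z
      rw [sum_update_right] at hy hz
      exact hyz (add_right_cancel (hy.trans hz.symm))
    · push Not at hc
      refine ⟨0, fun g => ⟨0, ?_⟩⟩
      rwa [Finset.sum_congr rfl fun x _ => hc x _ (g₀ x)]
  choose y hy using hx₀
  rw [← Fintype.card_prod]
  refine Fintype.card_le_of_injective
    (fun g => ((⟨Function.update g x₀ (y g), hy g⟩ : {g : F → F // ∑ x, h x (g x) ≠ 0}), g x₀))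
    fun g g' hgg => ?_
  simp only [Prod.mk.injEq, Subtype.mk.injEq] at hgg
  have := congrArg (fun k => Function.update k x₀ (g x₀)) hgg.1
  simp only [Function.update_idem, Function.update_eq_self] at this
  rw [this, hgg.2, Function.update_eq_self]

theorem card_transversalSum_eq_zero_le {F : Type*} [Field F] [Fintype F]
    (π : Equiv.Perm (F × F)) {w : F × F → F} (hw : w ∉ transversalKer π) :
    (Nat.card {g : F → F // transversalSum π g w = 0} : ℝ) ≤
      (Fintype.card F : ℝ) ^ Fintype.card F * (1 - 1 / (Fintype.card F : ℝ)) := by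
  classical
  rw [mem_transversalKer] at hw
  push Not at hw
  obtain ⟨g₀, hg₀⟩ := hw
  rw [transversalSum_apply] at hg₀
  have h1 := card_fun_le_card_sum_ne_zero_mul (fun x y => w (π (x, y))) g₀ hg₀
  have h2 := Fintype.card_subtype_compl fun g : F → F => ∑ x, w (π (x, g x)) = 0
  have h3 := Fintype.card_subtype_le fun g : F → F => ∑ x, w (π (x, g x)) = 0
  simp only [transversalSum_apply, Nat.card_eq_fintype_card]
  simp only [ne_eq] at h1
  rw [h2] at h1
  have h4 : (Fintype.card (F → F) : ℝ) = (Fintype.card F : ℝ) ^ Fintype.card F := by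
    rw [Fintype.card_fun]; push_cast; rfl
  have hq : (0 : ℝ) < Fintype.card F := by exact_mod_cast Fintype.card_pos
  have h5 := (Nat.cast_le (α := ℝ)).2 h1
  rw [Nat.cast_mul, Nat.cast_sub h3, h4, ← div_le_iff₀ hq] at h5
  rw [mul_sub, mul_one, mul_one_div]
  linarith

/-- **Proposition, Case (2).** Let `π` be any permutation of `F × F` and
`m` a positive integer. For `f_1, …, f_m : F → F`, let `T_i = {π(x, f_i(x)) : x ∈ F}` and
`M i (α,β) = 1` iff `(α,β) ∈ T_i`. Then for independent uniformly random `f_1, …, f_m`,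
the probability that `rank(M) = q² - q + 1` is at least `1 − q^(q²) · (1 − 1/q)^m`. -/
theorem prob_full_rank_case_two (F : Type*) [Field F] [Fintype F]
    (q : ℕ) (hq : q = Fintype.card F)
    (π : Equiv.Perm (F × F)) (m : ℕ) (hm : 0 < m) :
    1 - (q : ℝ) ^ (q ^ 2) * (1 - 1 / (q : ℝ)) ^ m
      ≤ (Nat.card {f : Fin m → F → F // (Mmat π f).rank = q ^ 2 - q + 1} : ℝ)
          / (q : ℝ) ^ (q * m) := by
  classical
  subst hq
  set q := Fintype.card F with hq
  have hq0 : (0 : ℝ) < q := by exact_mod_cast Fintype.card_pos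
  let good : Finset (Fin m → F → F) := {f | (Mmat π f).rank = q ^ 2 - q + 1}
  let vanish (w : F × F → F) : Finset (Fin m → F → F) := {f | ∀ i, transversalSum π (f i) w = 0}
  let bad : Finset (F × F → F) := {w | w ∉ transversalKer π}
  have hcover : (Finset.univ : Finset (Fin m → F → F)) ⊆ good ∪ bad.biUnion vanish := by
    intro f _
    by_cases hf : ∀ w, (∀ i, transversalSum π (f i) w = 0) → w ∈ transversalKer π
    · exact Finset.mem_union_left _ (by simpa [good] using rank_Mmat_eq π f hf)
    · push Not at hf
      exact Finset.mem_union_right _ (by simpa [bad, vanish, and_comm] using hf)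
  have hvanish : ∀ w ∈ bad,
      ((vanish w).card : ℝ) ≤ ((q : ℝ) ^ q * (1 - 1 / (q : ℝ))) ^ m := by
    intro w hw
    have hcard : (vanish w).card = Nat.card {g : F → F // transversalSum π g w = 0} ^ m := by
      rw [← Fintype.card_subtype, ← Nat.card_eq_fintype_card,
        Nat.card_congr (Equiv.subtypePiEquivPi (p := fun _ g => transversalSum π g w = 0)),
        Nat.card_fun, Nat.card_fin]
    rw [hcard, Nat.cast_pow]
    exact pow_le_pow_left₀ (Nat.cast_nonneg _)
      (card_transversalSum_eq_zero_le π (by simpa [bad] using hw)) m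
  have hq1 : 0 ≤ 1 - 1 / (q : ℝ) := by
    rw [sub_nonneg, div_le_one hq0]
    exact_mod_cast Fintype.card_pos (α := F)
  have hbad : (bad.card : ℝ) ≤ (q : ℝ) ^ (q ^ 2) := by
    have h : bad.card ≤ q ^ (q ^ 2) := by
      refine (Finset.card_le_univ _).trans_eq ?_
      rw [Fintype.card_fun, Fintype.card_prod, sq]
    exact_mod_cast h
  have htotal : (q : ℝ) ^ (q * m) ≤ good.card + ∑ w ∈ bad, ((vanish w).card : ℝ) := by
    have h := (Finset.card_le_card hcover).trans ((Finset.card_union_le _ _).trans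
      (Nat.add_le_add_left Finset.card_biUnion_le _))
    rw [Finset.card_univ, Fintype.card_fun, Fintype.card_fun, Fintype.card_fin, ← pow_mul] at h
    exact_mod_cast h
  have hsum : ∑ w ∈ bad, ((vanish w).card : ℝ) ≤
      (q : ℝ) ^ (q ^ 2) * ((q : ℝ) ^ q * (1 - 1 / (q : ℝ))) ^ m := by
    refine (Finset.sum_le_card_nsmul _ _ _ hvanish).trans ?_
    rw [nsmul_eq_mul]
    exact mul_le_mul_of_nonneg_right hbad (by positivity)
  have hgood : Nat.card {f : Fin m → F → F // (Mmat π f).rank = q ^ 2 - q + 1} = good.card := by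
    rw [Nat.card_eq_fintype_card, Fintype.card_subtype]
  rw [hgood, le_div_iff₀ (by positivity)]
  rw [mul_pow, ← pow_mul] at hsum
  linarith
end
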